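/- Let q, n ≥ 0 and suppose μ ∈ V_{q+n} satisfies conditions (h1) and (h4) (here (h1) includes the Jacobi identity and the invariance μ(ℝ^q,ℝ^q) ⊆ ℝ^q, μ(ℝ^q,ℝ^n) ⊆ ℝ^n). Then for all z, w ∈ ℝ^q, the element μ(z,w) ∈ ℝ^q is the unique u ∈ ℝ^q such that ad_μ u|_{ℝ^n} = (ad_μ z|_{ℝ^n}) ∘ (ad_μ w|_{ℝ^n}) − (ad_μ w|_{ℝ^n}) ∘ (ad_μ z|_{ℝ^n}). In particular, the restriction μ|_{ℝ^q×ℝ^q} is completely determined by the restriction μ|_{ℝ^q×ℝ^n}. -/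

import Mathlib

open scoped BigOperators

noncomputable section

/-- Euclidean space `ℝ^m` as functions `Fin m → ℝ`. -/
abbrev Eu (m : ℕ) := Fin m → ℝ

/-- The space of bilinear maps `ℝ^{q+n} × ℝ^{q+n} → ℝ^{q+n}`. -/
abbrev Bil (q n : ℕ) := Eu (q + n) →ₗ[ℝ] Eu (q + n) →ₗ[ℝ] Eu (q + n)

/-- Skew-symmetry: membership in `V_{q+n}`. -/
def Skew (q n : ℕ) (μ : Bil q n) : Prop := ∀ x y, μ x y = - μ y x

/-- Membership in the `ℝ^q`-factor (first `q` coordinates). -/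
def inK (q n : ℕ) (x : Eu (q + n)) : Prop := ∀ i : Fin (q + n), q ≤ (i : ℕ) → x i = 0

/-- Membership in the `ℝ^n`-factor (last `n` coordinates). -/
def inP (q n : ℕ) (x : Eu (q + n)) : Prop := ∀ i : Fin (q + n), (i : ℕ) < q → x i = 0

/-- The canonical inner product. -/
def dotE (m : ℕ) (x y : Eu m) : ℝ := ∑ i, x i * y i

/-- Condition (h1): Jacobi identity, `μ(ℝ^q,ℝ^q) ⊆ ℝ^q` and `μ(ℝ^q,ℝ^n) ⊆ ℝ^n`. -/
def H1 (q n : ℕ) (μ : Bil q n) : Prop :=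
  (∀ x y z, μ x (μ y z) + μ y (μ z x) + μ z (μ x y) = 0) ∧
  (∀ x y, inK q n x → inK q n y → inK q n (μ x y)) ∧
  (∀ x y, inK q n x → inP q n y → inP q n (μ x y))

/-- Condition (h3): `ad_μ z|_{ℝ^n}` is skew-symmetric for every `z ∈ ℝ^q`. -/
def H3 (q n : ℕ) (μ : Bil q n) : Prop :=
  ∀ z x y, inK q n z → inP q n x → inP q n y →
    dotE (q + n) (μ z x) y = - dotE (q + n) x (μ z y)

/-- Condition (h4): almost-effectiveness. -/
def H4 (q n : ℕ) (μ : Bil q n) : Prop :=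
  ∀ z, inK q n z → (∀ x, inP q n x → μ z x = 0) → z = 0

/-- Inclusion `ℝ^q → ℝ^{q+n}` onto the first `q` coordinates. -/
def emK (q n : ℕ) : Eu q →ₗ[ℝ] Eu (q + n) where
  toFun z := fun i => if h : (i : ℕ) < q then z ⟨i, h⟩ else 0
  map_add' x y := by funext i; by_cases h : (i : ℕ) < q <;> simp [h]
  map_smul' c x := by funext i; by_cases h : (i : ℕ) < q <;> simp [h]

/-- Inclusion `ℝ^n → ℝ^{q+n}` onto the last `n` coordinates. -/
def emP (q n : ℕ) : Eu n →ₗ[ℝ] Eu (q + n) where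
  toFun x := fun i => if h : q ≤ (i : ℕ) then x ⟨(i : ℕ) - q, by have := i.isLt; omega⟩ else 0
  map_add' x y := by funext i; by_cases h : q ≤ (i : ℕ) <;> simp [h]
  map_smul' c x := by funext i; by_cases h : q ≤ (i : ℕ) <;> simp [h]

/-- Projection `ℝ^{q+n} → ℝ^q` (first `q` coordinates). -/
def prK (q n : ℕ) : Eu (q + n) →ₗ[ℝ] Eu q where
  toFun v := fun i => v ⟨(i : ℕ), by have := i.isLt; omega⟩
  map_add' x y := rfl
  map_smul' c x := rfl

/-- Projection `ℝ^{q+n} → ℝ^n` (last `n` coordinates). -/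
def prP (q n : ℕ) : Eu (q + n) →ₗ[ℝ] Eu n where
  toFun v := fun i => v ⟨q + (i : ℕ), by have := i.isLt; omega⟩
  map_add' x y := rfl
  map_smul' c x := rfl

/-- The restriction `ad_μ z|_{ℝ^n} : ℝ^n → ℝ^n` for `z ∈ ℝ^q`. -/
def restAdP (q n : ℕ) (μ : Bil q n) (z : Eu q) : Eu n →ₗ[ℝ] Eu n :=
  (prP q n) ∘ₗ (μ (emK q n z)) ∘ₗ (emP q n)

/-- The restriction `ad_μ z|_{ℝ^q} : ℝ^q → ℝ^q` for `z ∈ ℝ^q`. -/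
def restAdK (q n : ℕ) (μ : Bil q n) (z : Eu q) : Eu q →ₗ[ℝ] Eu q :=
  (prK q n) ∘ₗ (μ (emK q n z)) ∘ₗ (emK q n)

/-- Transpose of an endomorphism of `ℝ^n` with respect to the canonical basis. -/
def tmap (n : ℕ) (f : Eu n →ₗ[ℝ] Eu n) : Eu n →ₗ[ℝ] Eu n :=
  Matrix.toLin' (LinearMap.toMatrix' f).transpose

/-- The `GL_{q+n}(ℝ)`-action `(h.μ)(x,y) = h μ(h⁻¹x, h⁻¹y)` on brackets. -/
def act (q n : ℕ) (h : Eu (q + n) ≃ₗ[ℝ] Eu (q + n)) (μ : Bil q n) : Bil q n :=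
  ((μ.comp h.symm.toLinearMap).compl₂ h.symm.toLinearMap).compr₂ h.toLinearMap

/-- The restricted bracket on the `ℝ^q`-factor. -/
def brK (q n : ℕ) (μ : Bil q n) (z w : Eu q) : Eu q :=
  prK q n (μ (emK q n z) (emK q n w))

theorem inK_emK (q n : ℕ) (z : Eu q) : inK q n (emK q n z) := fun i hi => by
  simp [emK, Nat.not_lt.mpr hi]

theorem inP_emP (q n : ℕ) (x : Eu n) : inP q n (emP q n x) := fun i hi => by
  simp [emP, Nat.not_le.mpr hi]

theorem emK_prK {q n : ℕ} {v : Eu (q + n)} (hv : inK q n v) : emK q n (prK q n v) = v := by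
  funext i
  by_cases h : (i : ℕ) < q
  · simp [emK, prK, h]
  · simp [emK, h, hv i (Nat.not_lt.mp h)]

theorem emP_prP {q n : ℕ} {v : Eu (q + n)} (hv : inP q n v) : emP q n (prP q n v) = v := by
  funext i
  by_cases h : q ≤ (i : ℕ)
  · simp [emP, prP, h]
  · simp [emP, h, hv i (Nat.not_le.mp h)]

theorem prK_emK (q n : ℕ) (z : Eu q) : prK q n (emK q n z) = z := by
  funext i
  simp [emK, prK]

theorem emK_brK {q n : ℕ} {μ : Bil q n} (h1 : H1 q n μ) (z w : Eu q) :
    emK q n (brK q n μ z w) = μ (emK q n z) (emK q n w) :=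
  emK_prK (h1.2.1 _ _ (inK_emK q n z) (inK_emK q n w))

theorem emP_restAdP {q n : ℕ} {μ : Bil q n} (h1 : H1 q n μ) (z : Eu q) (x : Eu n) :
    emP q n (restAdP q n μ z x) = μ (emK q n z) (emP q n x) :=
  emP_prP (h1.2.2 _ _ (inK_emK q n z) (inP_emP q n x))

/-- The Jacobi identity: `z ↦ ad_μ z|_{ℝ^n}` takes brackets to commutators. -/
theorem restAdP_brK {q n : ℕ} {μ : Bil q n} (hμ : Skew q n μ) (h1 : H1 q n μ) (z w : Eu q) :
    restAdP q n μ (brK q n μ z w)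
      = restAdP q n μ z ∘ₗ restAdP q n μ w - restAdP q n μ w ∘ₗ restAdP q n μ z := by
  refine LinearMap.ext fun x => ?_
  have hJ := h1.1 (emK q n z) (emK q n w) (emP q n x)
  rw [hμ (emP q n x) (emK q n z), map_neg, hμ (emP q n x)] at hJ
  change prP q n (μ (emK q n (brK q n μ z w)) (emP q n x)) =
    prP q n (μ (emK q n z) (emP q n (restAdP q n μ w x)))
      - prP q n (μ (emK q n w) (emP q n (restAdP q n μ z x)))
  rw [emK_brK h1, emP_restAdP h1, emP_restAdP h1, ← map_sub]
  congr 1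
  rw [← sub_eq_add_neg, ← sub_eq_add_neg, sub_eq_zero] at hJ
  exact hJ.symm

/-- Almost-effectiveness: `z ↦ ad_μ z|_{ℝ^n}` is injective on `ℝ^q`. -/
theorem restAdP_injective {q n : ℕ} {μ : Bil q n} (h1 : H1 q n μ) (h4 : H4 q n μ) :
    Function.Injective (restAdP q n μ) := by
  intro u v huv
  have h : emK q n (u - v) = 0 := by
    refine h4 _ (inK_emK q n _) fun x hx => ?_
    rw [← emP_prP hx, map_sub, map_sub, LinearMap.sub_apply, ← emP_restAdP h1, ← emP_restAdP h1, huv,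
      sub_self]
  rw [← sub_eq_zero, ← prK_emK q n (u - v), h, map_zero]

/-- under (h1) and (h4), `μ(z,w)` is the unique `u ∈ ℝ^q` with
`ad_μ u|_{ℝ^n} = [ad_μ z|_{ℝ^n}, ad_μ w|_{ℝ^n}]`; in particular `μ|_{ℝ^q×ℝ^q}` is
determined by `μ|_{ℝ^q×ℝ^n}`. -/
theorem bracket_on_K_determined
    (q n : ℕ) (μ : Bil q n) (hμ : Skew q n μ)
    (h1 : H1 q n μ) (h4 : H4 q n μ) :
    (∀ z w : Eu q,
      restAdP q n μ (brK q n μ z w)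
        = restAdP q n μ z ∘ₗ restAdP q n μ w - restAdP q n μ w ∘ₗ restAdP q n μ z ∧
      (∀ u : Eu q,
        restAdP q n μ u
          = restAdP q n μ z ∘ₗ restAdP q n μ w - restAdP q n μ w ∘ₗ restAdP q n μ z →
        u = brK q n μ z w)) ∧
    (∀ ν : Bil q n, Skew q n ν → H1 q n ν → H4 q n ν →
      (∀ (z : Eu q) (x : Eu n), ν (emK q n z) (emP q n x) = μ (emK q n z) (emP q n x)) →
      ∀ z w : Eu q, ν (emK q n z) (emK q n w) = μ (emK q n z) (emK q n w)) := by
  refine ⟨fun z w => ⟨restAdP_brK hμ h1 z w, fun u hu =>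
    restAdP_injective h1 h4 (hu.trans (restAdP_brK hμ h1 z w).symm)⟩, ?_⟩
  intro ν hν h1ν _ hνμ z w
  have hres : ∀ z, restAdP q n ν z = restAdP q n μ z := fun z =>
    LinearMap.ext fun x => congrArg (prP q n) (hνμ z x)
  have hbr : brK q n ν z w = brK q n μ z w := by
    apply restAdP_injective h1 h4
    rw [restAdP_brK hμ h1, ← hres, restAdP_brK hν h1ν, hres, hres]
  rw [← emK_brK h1ν, hbr, emK_brK h1]
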